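/- Let 𝕂 be a field, n ≥ 2, N = n(n−1)/2, z = (z_1,…,z_N) ∈ (𝕂ˣ)^N, and u := x_{−i_1}(z_1)·x_{−i_2}(z_2)⋯x_{−i_N}(z_N) where (i_1,…,i_N) = 𝐢₀. Then for all 1 ≤ k ≤ n−1 and 1 ≤ a ≤ n−k, the minor of uᵀ with row set {1,…,n−a} and column set {1,…,k} ∪ {k+a+1,…,n} equals ∏_{1≤m≤k+s_a, i_m = k} z_m⁻¹. -/

import Mathlib

open Matrix

/-- `yMat n 𝕂 i z` is the n×n identity matrix except entry (i+1, i) (1-based) equals `z`. -/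
def yMat (n : ℕ) (𝕂 : Type*) [Field 𝕂] (i : ℕ) (z : 𝕂) :
    Matrix (Fin n) (Fin n) 𝕂 :=
  fun a b => if a = b then 1 else if (a : ℕ) = i ∧ (b : ℕ) + 1 = i then z else 0

/-- `xMat n 𝕂 i z` is the n×n identity matrix except entry (i, i+1) (1-based) equals `z`. -/
def xMat (n : ℕ) (𝕂 : Type*) [Field 𝕂] (i : ℕ) (z : 𝕂) :
    Matrix (Fin n) (Fin n) 𝕂 :=
  fun a b => if a = b then 1 else if (a : ℕ) + 1 = i ∧ (b : ℕ) = i then z else 0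

/-- `xNegMat n 𝕂 i z` is the identity except the 2×2 block in rows/cols i, i+1 (1-based)
equals [[z⁻¹, 0], [1, z]]. -/
noncomputable def xNegMat (n : ℕ) (𝕂 : Type*) [Field 𝕂] (i : ℕ) (z : 𝕂) :
    Matrix (Fin n) (Fin n) 𝕂 :=
  fun a b =>
    if (a : ℕ) + 1 = i ∧ (b : ℕ) + 1 = i then z⁻¹
    else if (a : ℕ) = i ∧ (b : ℕ) = i then z
    else if (a : ℕ) = i ∧ (b : ℕ) + 1 = i then 1
    else if a = b then 1 else 0

/-- The matrix w̄₀ with (i, n+1−i) entry (−1)^(n−i) (1-based) and other entries 0. -/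
def w0bar (n : ℕ) (𝕂 : Type*) [Field 𝕂] : Matrix (Fin n) (Fin n) 𝕂 :=
  fun a b => if (a : ℕ) + (b : ℕ) = n - 1 then (-1 : 𝕂) ^ (n - 1 - (a : ℕ)) else 0

/-- s_k = Σ_{j=1}^{k−1} (n−j). -/
def sIdx (n k : ℕ) : ℕ := ∑ j ∈ Finset.Icc 1 (k - 1), (n - j)

/-- The word 𝐢₀ = (1,2,…,n−1, 1,2,…,n−2, …, 1,2, 1). -/
def wordI0 (n : ℕ) : List ℕ :=
  (List.range (n - 1)).flatMap (fun k => (List.range (n - 1 - k)).map (· + 1))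

/-- The word 𝐢′₀ = (n−1,…,1, n−1,…,2, …, n−1,n−2, n−1). -/
def wordI0' (n : ℕ) : List ℕ :=
  (List.range (n - 1)).flatMap (fun k => (List.range (n - 1 - k)).map (fun a => n - 1 - a))

/-- The simple reflection s_i = (i, i+1) (1-based) as a permutation of `Fin n`. -/
def sPerm (n i : ℕ) : Equiv.Perm (Fin n) :=
  if h : 1 ≤ i ∧ i < n then Equiv.swap ⟨i - 1, by omega⟩ ⟨i, h.2⟩ else 1

/-- The longest element of S_n, k ↦ n+1−k (1-based). -/
def w0Perm (n : ℕ) : Equiv.Perm (Fin n) where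
  toFun a := ⟨n - 1 - (a : ℕ), by have := a.isLt; omega⟩
  invFun a := ⟨n - 1 - (a : ℕ), by have := a.isLt; omega⟩
  left_inv a := by
    have := a.isLt
    apply Fin.ext
    show n - 1 - (n - 1 - (a : ℕ)) = (a : ℕ)
    omega
  right_inv a := by
    have := a.isLt
    apply Fin.ext
    show n - 1 - (n - 1 - (a : ℕ)) = (a : ℕ)
    omega

/-- Apply a permutation of `Fin n` to a 1-based label in {1, …, n}. -/
def permApp {n : ℕ} (σ : Equiv.Perm (Fin n)) (x : ℕ) : ℕ :=
  if h : 1 ≤ x ∧ x ≤ n then ((σ ⟨x - 1, by omega⟩ : Fin n) : ℕ) + 1 else x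


/-- The diagonal weight `w` on the indices `1, …, m`, extended by `1`. -/
def cutWeight {𝕂 : Type*} [Field 𝕂] (m : ℕ) (w : ℕ → 𝕂) (r : ℕ) : 𝕂 :=
  if 1 ≤ r ∧ r ≤ m then w r else 1

/-- The lower bidiagonal matrix `x_{-1}(w 1) ⋯ x_{-m}(w m)`. -/
noncomputable def bidiagMat (n : ℕ) (𝕂 : Type*) [Field 𝕂] (m : ℕ) (w : ℕ → 𝕂) :
    Matrix (Fin n) (Fin n) 𝕂 :=
  fun r c =>
    if r = c then cutWeight m w r * (cutWeight m w (r + 1))⁻¹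
    else if (r : ℕ) = c + 1 ∧ (r : ℕ) ≤ m then 1 else 0

section Bidiagonal

variable {𝕂 : Type*} [Field 𝕂] {n : ℕ}

theorem mul_xNegMat_apply (M : Matrix (Fin n) (Fin n) 𝕂) (m : ℕ) (hm : m + 1 < n) (x : 𝕂)
    (r c : Fin n) :
    (M * xNegMat n 𝕂 (m + 1) x) r c =
      if (c : ℕ) = m then M r c * x⁻¹ + M r ⟨m + 1, hm⟩
      else if (c : ℕ) = m + 1 then M r c * x else M r c := by
  rw [Matrix.mul_apply]
  split_ifs with h1 h2
  · have hne : c ≠ ⟨m + 1, hm⟩ := by intro h; rw [h] at h1; simp at h1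
    rw [Fintype.sum_eq_add c ⟨m + 1, hm⟩ hne]
    · simp [xNegMat, h1]
    · rintro b ⟨hb1, hb2⟩
      have hb1' : (b : ℕ) ≠ c := fun h => hb1 (Fin.ext h)
      have hb2' : (b : ℕ) ≠ m + 1 := fun h => hb2 (Fin.ext h)
      have : (b : ℕ) ≠ m := by omega
      simp [xNegMat, hb1, hb2', this]
  · rw [Fintype.sum_eq_single c]
    · simp [xNegMat, h2]
    · intro b hb
      have hb' : (b : ℕ) ≠ m + 1 := fun h => hb (Fin.ext (by omega))
      simp [xNegMat, hb, h2, hb']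
  · rw [Fintype.sum_eq_single c]
    · simp [xNegMat, h1, h2]
    · intro b hb
      simp [xNegMat, hb, h1, h2]

theorem prod_xNegMat_eq_bidiagMat (m : ℕ) (hm : m < n) (w : ℕ → 𝕂) :
    ((List.range m).map (fun t => xNegMat n 𝕂 (t + 1) (w (t + 1)))).prod =
      bidiagMat n 𝕂 m w := by
  induction m with
  | zero =>
    ext r c
    have h : ∀ r, cutWeight 0 w r = 1 := fun r => if_neg (by omega)
    have h0 : ¬ ((r : ℕ) = c + 1 ∧ (r : ℕ) ≤ 0) := by omega
    simp only [List.range_zero, List.map_nil, List.prod_nil, bidiagMat, h, if_neg h0,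
      Matrix.one_apply, inv_one, mul_one]
  | succ m ih =>
    rw [List.range_succ, List.map_append, List.prod_append, ih (by omega)]
    simp only [List.map_cons, List.map_nil, List.prod_cons, List.prod_nil, mul_one]
    ext r c
    rw [mul_xNegMat_apply _ m hm]
    simp only [bidiagMat, cutWeight, Fin.ext_iff]
    grind

theorem bidiagMat_self (m : ℕ) (w : ℕ → 𝕂) (r : Fin n) :
    bidiagMat n 𝕂 m w r r = cutWeight m w r * (cutWeight m w (r + 1))⁻¹ := by
  simp [bidiagMat]

theorem bidiagMat_of_lt (m : ℕ) (w : ℕ → 𝕂) {r c : Fin n} (h : r < c) :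
    bidiagMat n 𝕂 m w r c = 0 := by
  have h' : (r : ℕ) < c := h
  simp only [bidiagMat, if_neg h.ne]
  exact if_neg (by omega)

theorem bidiagMat_of_gt (m : ℕ) (w : ℕ → 𝕂) {r c : Fin n} (h : (c : ℕ) + 1 < r) :
    bidiagMat n 𝕂 m w r c = 0 := by
  have h' : r ≠ c := by rintro rfl; omega
  simp only [bidiagMat, if_neg h']
  exact if_neg (by omega)

theorem bidiagMat_of_gt_cut (m : ℕ) (w : ℕ → 𝕂) {r c : Fin n} (hr : m < r) (h : c < r) :
    bidiagMat n 𝕂 m w r c = 0 := by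
  simp only [bidiagMat, if_neg h.ne']
  exact if_neg (by omega)

theorem bidiagMat_succ (m : ℕ) (w : ℕ → 𝕂) {r c : Fin n} (h : (r : ℕ) = c + 1)
    (hr : (r : ℕ) ≤ m) : bidiagMat n 𝕂 m w r c = 1 := by
  have h' : r ≠ c := by rintro rfl; omega
  simp only [bidiagMat, if_neg h']
  exact if_pos ⟨h, hr⟩

theorem prod_cutWeight (m : ℕ) (w : ℕ → 𝕂) (hw : ∀ r, 1 ≤ r → r ≤ m → w r ≠ 0) (q : ℕ) :
    ∏ r ∈ Finset.range q, cutWeight m w r * (cutWeight m w (r + 1))⁻¹ =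
      (cutWeight m w q)⁻¹ := by
  induction q with
  | zero => simp [cutWeight]
  | succ q ih =>
    have h : cutWeight m w q ≠ 0 := by
      unfold cutWeight
      split_ifs with h
      · exact hw q h.1 h.2
      · exact one_ne_zero
    rw [Finset.prod_range_succ, ih, inv_mul_cancel_left₀ h]

/-- Right multiplication by a bidiagonal matrix supported on the first `q` indices does not
change the minors on the first `q` columns. -/
theorem det_submatrix_mul_bidiagMat (A : Matrix (Fin n) (Fin n) 𝕂) {q m : ℕ} (hq : q ≤ n)
    (hm : m < q) (w : ℕ → 𝕂) (hw : ∀ r, 1 ≤ r → r ≤ m → w r ≠ 0) (f : Fin q → Fin n) :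
    ((A * bidiagMat n 𝕂 m w).submatrix f (Fin.castLE hq)).det =
      (A.submatrix f (Fin.castLE hq)).det := by
  have hmul : (A * bidiagMat n 𝕂 m w).submatrix f (Fin.castLE hq) =
      A.submatrix f (Fin.castLE hq) *
        (bidiagMat n 𝕂 m w).submatrix (Fin.castLE hq) (Fin.castLE hq) := by
    ext r c
    simp only [Matrix.submatrix_apply, Matrix.mul_apply]
    symm
    refine Fintype.sum_of_injective (Fin.castLE hq) (Fin.castLE_injective hq) _ _ ?_ ?_
    · intro b hb
      have hbq : q ≤ b := by
        by_contra! h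
        exact hb ⟨⟨b, h⟩, rfl⟩
      have hc : (c : ℕ) < q := c.isLt
      rw [bidiagMat_of_gt_cut, mul_zero]
      · omega
      · exact Fin.lt_def.2 (by simp only [Fin.val_castLE]; omega)
    · intro b; rfl
  have hdet : ((bidiagMat n 𝕂 m w).submatrix (Fin.castLE hq) (Fin.castLE hq)).det = 1 := by
    rw [Matrix.det_of_isLowerTriangular]
    · simp only [Matrix.submatrix_apply, bidiagMat_self, Fin.val_castLE]
      rw [Fin.prod_univ_eq_prod_range
        (fun r => cutWeight m w r * (cutWeight m w (r + 1))⁻¹) q, prod_cutWeight m w hw]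
      rw [cutWeight, if_neg (by omega), inv_one]
    · intro r c h
      exact bidiagMat_of_lt m w (Fin.lt_def.2 (OrderDual.toDual_lt_toDual.1 h))
  rw [hmul, Matrix.det_mul, hdet, mul_one]

end Bidiagonal

/-- A matrix with a vanishing upper right block, a lower triangular upper left block and an upper
triangular lower right block has determinant the product of its diagonal. -/
theorem Matrix.det_eq_prod_diag_of_lower_upper {R : Type*} [CommRing R] {q : ℕ} (k : ℕ)
    (M : Matrix (Fin q) (Fin q) R)
    (h₁ : ∀ i j : Fin q, (i : ℕ) < k → i < j → M i j = 0)
    (h₂ : ∀ i j : Fin q, k ≤ (j : ℕ) → j < i → M i j = 0) :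
    M.det = ∏ i, M i i := by
  rw [Matrix.twoBlockTriangular_det' M (fun i => (i : ℕ) < k)
    (fun i hi j hj => h₁ i j hi (Fin.lt_def.2 (by omega)))]
  rw [Matrix.det_of_isLowerTriangular, Matrix.det_of_isUpperTriangular]
  · exact Fintype.prod_subtype_mul_prod_subtype (fun i : Fin q => (i : ℕ) < k) (fun i => M i i)
  · intro i j h
    exact h₂ i j (not_lt.1 j.2) h
  · intro i j h
    exact h₁ i j i.2 (OrderDual.toDual_lt_toDual.1 h)

section BidiagonalProduct

variable {𝕂 : Type*} [Field 𝕂] {n : ℕ}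

/-- The product of the first `p` bidiagonal matrices of sizes `n - 1, n - 2, …`. -/
noncomputable def bidiagProd (n : ℕ) (𝕂 : Type*) [Field 𝕂] (w : ℕ → ℕ → 𝕂) (p : ℕ) :
    Matrix (Fin n) (Fin n) 𝕂 :=
  ((List.range p).map (fun j => bidiagMat n 𝕂 (n - 1 - j) (w j))).prod

theorem bidiagProd_succ (w : ℕ → ℕ → 𝕂) (p : ℕ) :
    bidiagProd n 𝕂 w (p + 1) = bidiagProd n 𝕂 w p * bidiagMat n 𝕂 (n - 1 - p) (w p) := by
  simp [bidiagProd, List.range_succ]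

theorem bidiagProd_zero (w : ℕ → ℕ → 𝕂) : bidiagProd n 𝕂 w 0 = 1 := by
  simp [bidiagProd]

theorem bidiagProd_of_lt (w : ℕ → ℕ → 𝕂) (p : ℕ) {r c : Fin n} (h : r < c) :
    bidiagProd n 𝕂 w p r c = 0 := by
  induction p generalizing c with
  | zero => rw [bidiagProd_zero, Matrix.one_apply_ne h.ne]
  | succ p ih =>
    rw [bidiagProd_succ, Matrix.mul_apply]
    refine Finset.sum_eq_zero fun b _ => ?_
    rcases lt_or_ge b c with hb | hb
    · rw [bidiagMat_of_lt _ _ hb, mul_zero]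
    · rw [ih (h.trans_le hb), zero_mul]

theorem bidiagProd_of_gt (w : ℕ → ℕ → 𝕂) (p : ℕ) {r c : Fin n} (h : (c : ℕ) + p < r) :
    bidiagProd n 𝕂 w p r c = 0 := by
  induction p generalizing c with
  | zero => rw [bidiagProd_zero, Matrix.one_apply_ne (by rintro rfl; omega)]
  | succ p ih =>
    rw [bidiagProd_succ, Matrix.mul_apply]
    refine Finset.sum_eq_zero fun b _ => ?_
    rcases lt_or_ge ((c : ℕ) + 1) b with hb | hb
    · rw [bidiagMat_of_gt _ _ hb, mul_zero]
    · rw [ih (by omega), zero_mul]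

theorem bidiagProd_of_eq_add (w : ℕ → ℕ → 𝕂) (p : ℕ) {r c : Fin n} (h : (r : ℕ) = c + p) :
    bidiagProd n 𝕂 w p r c = 1 := by
  induction p generalizing c with
  | zero => rw [bidiagProd_zero, Fin.ext (h.trans (add_zero _)), Matrix.one_apply_eq]
  | succ p ih =>
    have hr := r.isLt
    have hc : (c : ℕ) + 1 < n := by omega
    rw [bidiagProd_succ, Matrix.mul_apply, Fintype.sum_eq_single ⟨c + 1, hc⟩]
    · rw [ih (by simp only; omega), bidiagMat_succ _ _ rfl (by simp only; omega), mul_one]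
    · intro b hb
      have hb' : (b : ℕ) ≠ c + 1 := fun h => hb (Fin.ext h)
      rcases lt_or_ge ((c : ℕ) + 1) b with hb | hb
      · rw [bidiagMat_of_gt _ _ hb, mul_zero]
      · rw [bidiagProd_of_gt w p (by omega), zero_mul]

theorem bidiagProd_self (w : ℕ → ℕ → 𝕂) (p : ℕ) (r : Fin n) :
    bidiagProd n 𝕂 w p r r = ∏ j ∈ Finset.range p,
      cutWeight (n - 1 - j) (w j) r * (cutWeight (n - 1 - j) (w j) (r + 1))⁻¹ := by
  induction p with
  | zero => simp [bidiagProd_zero]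
  | succ p ih =>
    rw [bidiagProd_succ, Matrix.mul_apply, Fintype.sum_eq_single r, ih, bidiagMat_self,
      Finset.prod_range_succ]
    intro b hb
    rcases lt_or_gt_of_ne hb with hb | hb
    · rw [bidiagMat_of_lt _ _ hb, mul_zero]
    · rw [bidiagProd_of_lt _ _ hb, zero_mul]

theorem det_submatrix_bidiagProd (w : ℕ → ℕ → 𝕂)
    (hw : ∀ j r, 1 ≤ r → r ≤ n - 1 - j → w j r ≠ 0) {a : ℕ} (ha : a < n) (p : ℕ) (hap : a ≤ p)
    (f : Fin (n - a) → Fin n) :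
    ((bidiagProd n 𝕂 w p).submatrix f (Fin.castLE (Nat.sub_le n a))).det =
      ((bidiagProd n 𝕂 w a).submatrix f (Fin.castLE (Nat.sub_le n a))).det := by
  induction p, hap using Nat.le_induction with
  | base => rfl
  | succ p hp ih =>
    rw [bidiagProd_succ, det_submatrix_mul_bidiagMat _ _ (by omega) _ (hw p), ih]

theorem det_bidiagProd_skip_rows (w : ℕ → ℕ → 𝕂)
    (hw : ∀ j r, 1 ≤ r → r ≤ n - 1 - j → w j r ≠ 0) {k a : ℕ} (hk : 1 ≤ k) (hka : k + a ≤ n)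
    (f : Fin (n - a) → Fin n)
    (hf : ∀ t, (f t : ℕ) = if (t : ℕ) < k then (t : ℕ) else (t : ℕ) + a) :
    ((bidiagProd n 𝕂 w a).submatrix f (Fin.castLE (Nat.sub_le n a))).det =
      ∏ j ∈ Finset.range a, (w j k)⁻¹ := by
  rw [Matrix.det_eq_prod_diag_of_lower_upper k]
  · have hdiag : ∀ t : Fin (n - a),
        (bidiagProd n 𝕂 w a).submatrix f (Fin.castLE (Nat.sub_le n a)) t t =
          if (t : ℕ) < k then ∏ j ∈ Finset.range a,
            cutWeight (n - 1 - j) (w j) t * (cutWeight (n - 1 - j) (w j) (t + 1))⁻¹ else 1 := by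
      intro t
      have ht := hf t
      rw [Matrix.submatrix_apply]
      split_ifs at ht ⊢ with h
      · have : f t = Fin.castLE (Nat.sub_le n a) t := Fin.ext ht
        rw [this, bidiagProd_self, Fin.val_castLE]
      · exact bidiagProd_of_eq_add w a ht
    rw [Finset.prod_congr rfl fun t _ => hdiag t, Fin.prod_univ_eq_prod_range
      (fun t => if t < k then ∏ j ∈ Finset.range a, cutWeight (n - 1 - j) (w j) t *
        (cutWeight (n - 1 - j) (w j) (t + 1))⁻¹ else 1) (n - a), ← Finset.prod_filter]
    have hrange : (Finset.range (n - a)).filter (· < k) = Finset.range k := by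
      ext t
      simp only [Finset.mem_filter, Finset.mem_range]
      omega
    rw [hrange, Finset.prod_comm]
    refine Finset.prod_congr rfl fun j hj => ?_
    have hj' := Finset.mem_range.1 hj
    rw [prod_cutWeight _ _ (hw j), cutWeight, if_pos ⟨hk, by omega⟩]
  · intro i j hi hij
    refine bidiagProd_of_lt w a (Fin.lt_def.2 ?_)
    rw [hf, if_pos hi]
    exact hij
  · intro i j hj hij
    refine bidiagProd_of_gt w a ?_
    rw [hf, if_neg (by omega), Fin.val_castLE]
    have : (j : ℕ) < i := hij
    omega

end BidiagonalProduct

theorem sIdx_one (n : ℕ) : sIdx n 1 = 0 := by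
  simp [sIdx]

theorem sIdx_add_two (n p : ℕ) : sIdx n (p + 2) = sIdx n (p + 1) + (n - 1 - p) := by
  simp only [sIdx, Nat.add_sub_cancel, show p + 2 - 1 = p + 1 by omega]
  rw [Finset.sum_Icc_succ_top (by omega)]
  omega

theorem sIdx_self {n : ℕ} (hn : 2 ≤ n) : sIdx n n = n * (n - 1) / 2 := by
  have h : ∀ p, p + 1 ≤ n → 2 * sIdx n (p + 1) + (n - p) * (n - 1 - p) = n * (n - 1) := by
    intro p hp
    induction p with
    | zero => simp [sIdx_one]
    | succ p ih =>
      rw [← ih (by omega), sIdx_add_two]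
      obtain ⟨d, rfl⟩ : ∃ d, n = p + 2 + d := ⟨n - (p + 2), by omega⟩
      rw [show p + 2 + d - (p + 1) = d + 1 by omega, show p + 2 + d - 1 - (p + 1) = d by omega,
        show p + 2 + d - 1 - p = d + 1 by omega, show p + 2 + d - p = d + 2 by omega]
      ring
  have := h (n - 1) (by omega)
  rw [show n - 1 + 1 = n by omega, Nat.sub_self, mul_zero] at this
  omega

theorem sIdx_mono (n : ℕ) : Monotone (sIdx n) := fun _ _ h =>
  Finset.sum_le_sum_of_subset (Finset.Icc_subset_Icc_right (Nat.sub_le_sub_right h 1))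

theorem length_flatMap_range (n p : ℕ) :
    ((List.range p).flatMap (fun k => (List.range (n - 1 - k)).map (· + 1))).length =
      sIdx n (p + 1) := by
  induction p with
  | zero => simp [sIdx_one]
  | succ p ih =>
    rw [List.range_succ, List.flatMap_append, List.length_append, ih, sIdx_add_two]
    simp

theorem wordI0_getD {n j t : ℕ} (ht : t < n - 1 - j) :
    (wordI0 n).getD (sIdx n (j + 1) + t) 0 = t + 1 := by
  have hsplit : ∃ l, wordI0 n =
      (List.range j).flatMap (fun k => (List.range (n - 1 - k)).map (· + 1)) ++
        ((List.range (n - 1 - j)).map (· + 1) ++ l) := by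
    obtain ⟨d, hd⟩ : ∃ d, n - 1 = j + 1 + d := ⟨n - 1 - (j + 1), by omega⟩
    refine ⟨((List.range d).map (j + 1 + ·)).flatMap
      (fun k => (List.range (n - 1 - k)).map (· + 1)), ?_⟩
    rw [wordI0, show List.range (n - 1) =
      List.range j ++ ([j] ++ (List.range d).map (j + 1 + ·)) by
        rw [hd, List.range_add, List.range_succ, List.append_assoc]]
    simp only [List.flatMap_append, List.flatMap_cons, List.flatMap_nil, List.append_nil]
  obtain ⟨l, hl⟩ := hsplit
  rw [hl, List.getD_append_right _ _ _ _ (by rw [length_flatMap_range]; omega),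
    length_flatMap_range, Nat.add_sub_cancel_left, List.getD_append _ _ _ _ (by simpa using ht)]
  simp [List.getD_eq_getElem?_getD, ht]

theorem list_prod_range_sIdx {M : Type*} [Monoid M] (n p : ℕ) (F : ℕ → M) :
    ((List.range (sIdx n (p + 1))).map F).prod =
      ((List.range p).map (fun j =>
        ((List.range (n - 1 - j)).map (fun t => F (sIdx n (j + 1) + t))).prod)).prod := by
  induction p with
  | zero => simp [sIdx_one]
  | succ p ih =>
    rw [sIdx_add_two, List.range_add, List.map_append, List.prod_append, ih, List.range_succ,
      List.map_append, List.prod_append]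
    simp [Function.comp_def]

theorem prod_wordI0_eq_bidiagProd {𝕂 : Type*} [Field 𝕂] {n : ℕ} (hn : 2 ≤ n) (z : ℕ → 𝕂) :
    ((List.range (sIdx n n)).map
      (fun t => xNegMat n 𝕂 ((wordI0 n).getD t 0) (z (t + 1)))).prod =
      bidiagProd n 𝕂 (fun j r => z (sIdx n (j + 1) + r)) (n - 1) := by
  obtain ⟨p, rfl⟩ : ∃ p, n = p + 1 := ⟨n - 1, by omega⟩
  rw [list_prod_range_sIdx, bidiagProd]
  congr 1
  refine List.map_congr_left fun j _ => ?_
  rw [← prod_xNegMat_eq_bidiagMat _ (by omega)]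
  congr 1
  refine List.map_congr_left fun t ht => ?_
  rw [wordI0_getD (List.mem_range.1 ht), add_assoc]

theorem prod_filter_wordI0 {M : Type*} [CommMonoid M] {n k a : ℕ} (hk : 1 ≤ k) (ha : 1 ≤ a)
    (hka : k + a ≤ n) (g : ℕ → M) :
    ∏ m ∈ (Finset.Icc 1 (k + sIdx n a)).filter (fun m => (wordI0 n).getD (m - 1) 0 = k), g m =
      ∏ j ∈ Finset.range a, g (sIdx n (j + 1) + k) := by
  obtain ⟨p, rfl⟩ : ∃ p, a = p + 1 := ⟨a - 1, by omega⟩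
  have hblock : ∀ j q, k ≤ q → q ≤ n - 1 - j →
      ∏ t ∈ Finset.range q, (if (wordI0 n).getD (sIdx n (j + 1) + t) 0 = k
        then g (sIdx n (j + 1) + t + 1) else 1) = g (sIdx n (j + 1) + k) := by
    intro j q hkq hq
    rw [Finset.prod_eq_single_of_mem (k - 1) (Finset.mem_range.2 (by omega))]
    · rw [wordI0_getD (by omega), if_pos (by omega), add_assoc, Nat.sub_add_cancel hk]
    · intro t ht htk
      have := Finset.mem_range.1 ht
      rw [wordI0_getD (by omega), if_neg (by omega)]
  have hfull : ∀ r, r ≤ p →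
      ∏ m ∈ Finset.range (sIdx n (r + 1)),
        (if (wordI0 n).getD m 0 = k then g (m + 1) else 1) =
        ∏ j ∈ Finset.range r, g (sIdx n (j + 1) + k) := by
    intro r hr
    induction r with
    | zero => simp [sIdx_one]
    | succ r ih =>
      rw [sIdx_add_two, Finset.prod_range_add, ih (by omega), Finset.prod_range_succ,
        hblock r _ (by omega) le_rfl]
  rw [Finset.prod_filter, ← Finset.Ico_add_one_right_eq_Icc, Finset.prod_Ico_eq_prod_range,
    Nat.add_sub_cancel, Nat.add_comm k, Finset.prod_range_add, Finset.prod_range_succ,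
    ← hfull p le_rfl, ← hblock p k le_rfl (by omega)]
  simp only [Nat.add_comm 1, Nat.add_sub_cancel]

/-- the minor of uᵀ with row set {1,…,n−a} and column set
{1,…,k} ∪ {k+a+1,…,n} equals ∏_{1≤m≤k+s_a, i_m = k} z_m⁻¹. -/
theorem stmt11
    (𝕂 : Type*) [Field 𝕂]
    (n N : ℕ) (hn : 2 ≤ n) (hN : N = n * (n - 1) / 2)
    (z : ℕ → 𝕂) (hz : ∀ j, 1 ≤ j → j ≤ N → z j ≠ 0)
    (u : Matrix (Fin n) (Fin n) 𝕂)
    (hu : u = ((List.range N).map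
      (fun t => xNegMat n 𝕂 ((wordI0 n).getD t 0) (z (t + 1)))).prod)
    (k a : ℕ) (hk : 1 ≤ k) (hk' : k ≤ n - 1) (ha : 1 ≤ a) (ha' : a ≤ n - k) :
    ((u.transpose).submatrix
        (fun t : Fin (n - a) => (⟨(t : ℕ), by have := t.isLt; omega⟩ : Fin n))
        (fun t : Fin (n - a) =>
          (⟨if (t : ℕ) < k then (t : ℕ) else (t : ℕ) + a,
            by have := t.isLt; split <;> omega⟩ : Fin n))).det =
      ∏ m ∈ (Finset.Icc 1 (k + sIdx n a)).filter
          (fun m => (wordI0 n).getD (m - 1) 0 = k), (z m)⁻¹ := by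
  subst hN
  rw [← sIdx_self hn] at hz hu
  rw [prod_wordI0_eq_bidiagProd hn] at hu
  have hw : ∀ j r, 1 ≤ r → r ≤ n - 1 - j → z (sIdx n (j + 1) + r) ≠ 0 := by
    intro j r hr hrj
    refine hz _ (by omega) ?_
    have h := sIdx_mono n (show j + 2 ≤ n by omega)
    rw [sIdx_add_two] at h
    omega
  rw [prod_filter_wordI0 hk ha (by omega), ← Matrix.det_transpose, Matrix.transpose_submatrix,
    Matrix.transpose_transpose, hu]
  exact (det_submatrix_bidiagProd _ hw (by omega) (n - 1) (by omega) _).trans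
    (det_bidiagProd_skip_rows _ hw hk (by omega) _ fun _ => rfl)
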